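/- arXiv:1904.11909 — 4 statements merged into one kernel-verified Lean document; each statement's English description precedes it below -/
import Mathlib

section
/- For any real coefficients a_0, a_1, …, a_N, the derivative of the nodal expansion telescopes into an edge expansion: d/dξ [ Σ_{i=0}^{N} a_i h_i(ξ) ] = Σ_{i=1}^{N} (a_i − a_{i−1}) e_i(ξ), as an identity of polynomials. -/
open Polynomial Finset

/-- Summation by parts, in terms of the partial sums of `d`. -/
theorem sum_range_succ_mul_eq_sum_Icc_sub_mul_neg {R : Type*} [CommRing R] (b d : ℕ → R) (n : ℕ) :
    ∑ i ∈ Finset.range (n + 1), b i * d i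
      = ∑ i ∈ Finset.Icc 1 n, (b i - b (i - 1)) * (-∑ k ∈ Finset.range i, d k)
        + b n * ∑ k ∈ Finset.range (n + 1), d k := by
  induction n with
  | zero => simp
  | succ n ih =>
    rw [Finset.sum_range_succ, ih, Finset.sum_Icc_succ_top (by omega),
      Finset.sum_range_succ d (n + 1), Nat.add_sub_cancel]
    ring

/-- Polynomials of degree at most `N` that are dual to the evaluations at `N + 1` distinct nodes
form a partition of unity. -/
theorem sum_eq_one_of_eval_eq_ite {N : ℕ} {ξ : ℕ → ℝ}
    (hξ : Set.InjOn ξ (Finset.range (N + 1))) {h : ℕ → Polynomial ℝ}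
    (hdeg : ∀ i, i ≤ N → (h i).degree ≤ (N : ℕ))
    (hval : ∀ i, i ≤ N → ∀ j, j ≤ N → (h i).eval (ξ j) = if i = j then 1 else 0) :
    ∑ i ∈ Finset.range (N + 1), h i = 1 := by
  have hN : ((N : ℕ) : WithBot ℕ) < ((Finset.range (N + 1)).card : ℕ) := by
    rw [Finset.card_range]
    exact_mod_cast N.lt_succ_self
  refine eq_of_degrees_lt_of_eval_index_eq (Finset.range (N + 1)) hξ ?_ ?_ ?_
  · refine lt_of_le_of_lt (degree_sum_le _ _) (lt_of_le_of_lt (Finset.sup_le fun i hi => ?_) hN)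
    exact hdeg i (Finset.mem_range_succ_iff.mp hi)
  · rw [degree_one]
    exact lt_of_le_of_lt (by exact_mod_cast N.zero_le) hN
  · intro j hj
    rw [eval_finsetSum, eval_one, Finset.sum_congr rfl fun i hi =>
      hval i (Finset.mem_range_succ_iff.mp hi) j (Finset.mem_range_succ_iff.mp hj),
      Finset.sum_ite_eq' _ _ _, if_pos hj]

/-- **Telescoping derivative of the nodal expansion (discrete derivative).**
Let `ξ 0 < ξ 1 < … < ξ N` (`N ≥ 1`) be distinct real nodes, `h i` the Lagrange basis
polynomials (`h i (ξ j) = δᵢⱼ`, degree `≤ N`), and `e j = -∑_{k=0}^{j-1} (h k)'` the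
edge polynomials.  Then for any real coefficients `a 0, …, a N`,
`d/dξ [∑_{i=0}^{N} a i · h i] = ∑_{i=1}^{N} (a i - a (i-1)) · e i`
as an identity of polynomials. -/
theorem derivative_nodal_expansion_eq_edge_expansion
    (N : ℕ) (hN : 1 ≤ N)
    (ξ : ℕ → ℝ) (hξ : ∀ i j, i < j → j ≤ N → ξ i < ξ j)
    (h : ℕ → Polynomial ℝ)
    (hdeg : ∀ i, i ≤ N → (h i).degree ≤ (N : ℕ))
    (hval : ∀ i, i ≤ N → ∀ j, j ≤ N → (h i).eval (ξ j) = if i = j then 1 else 0)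
    (e : ℕ → Polynomial ℝ)
    (he : ∀ j, e j = -∑ k ∈ Finset.range j, derivative (h k))
    (a : ℕ → ℝ) :
    derivative (∑ i ∈ Finset.range (N + 1), C (a i) * h i)
      = ∑ i ∈ Finset.Icc 1 N, C (a i - a (i - 1)) * e i := by
  have hinj : Set.InjOn ξ (Finset.range (N + 1)) := by
    refine StrictMonoOn.injOn fun i _ j hj hij => hξ i j hij ?_
    exact Finset.mem_range_succ_iff.mp hj
  have hsum : ∑ k ∈ Finset.range (N + 1), derivative (h k) = 0 := by
    rw [← derivative_sum, sum_eq_one_of_eval_eq_ite hinj hdeg hval, derivative_one]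
  simp only [derivative_sum, derivative_C_mul, he, C_sub]
  rw [sum_range_succ_mul_eq_sum_Icc_sub_mul_neg (fun i => C (a i)), hsum, mul_zero, add_zero]
end

section
/- The edge polynomials satisfy the Kronecker-delta integral property: for all i, j ∈ {1,…,N}, ∫_{ξ_{j−1}}^{ξ_j} e_i(ξ) dξ = δ_{ij}. -/
open Polynomial Finset

/-- **Kronecker-delta integral property of the edge polynomials.**
Let `ξ 0 < ξ 1 < … < ξ N` (`N ≥ 1`) be distinct real nodes, `h i` the Lagrange basis
polynomials (`h i (ξ j) = δᵢⱼ`, degree `≤ N`), and `e j = -∑_{k=0}^{j-1} (h k)'` the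
edge polynomials.  Then for all `i, j ∈ {1, …, N}`,
`∫_{ξ (j-1)}^{ξ j} e i (x) dx = δᵢⱼ`. -/
theorem edge_polynomial_integral_kronecker
    (N : ℕ) (hN : 1 ≤ N)
    (ξ : ℕ → ℝ) (hξ : ∀ i j, i < j → j ≤ N → ξ i < ξ j)
    (h : ℕ → Polynomial ℝ)
    (hdeg : ∀ i, i ≤ N → (h i).degree ≤ (N : ℕ))
    (hval : ∀ i, i ≤ N → ∀ j, j ≤ N → (h i).eval (ξ j) = if i = j then 1 else 0)
    (e : ℕ → Polynomial ℝ)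
    (he : ∀ j, e j = -∑ k ∈ Finset.range j, derivative (h k)) :
    ∀ i j, 1 ≤ i → i ≤ N → 1 ≤ j → j ≤ N →
      (∫ x in (ξ (j - 1))..(ξ j), (e i).eval x) = if i = j then 1 else 0 := by
  intro i j hi hiN hj hjN
  have hsum : ∀ m, m ≤ N →
      (∑ k ∈ Finset.range i, h k).eval (ξ m) = if m < i then 1 else 0 := by
    intro m hm
    have hterm : ∀ k ∈ Finset.range i, (h k).eval (ξ m) = if k = m then 1 else 0 :=
      fun k hk => hval k ((Finset.mem_range.mp hk).le.trans hiN) m hm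
    rw [eval_finsetSum, Finset.sum_congr rfl hterm, Finset.sum_ite_eq']
    simp only [Finset.mem_range]
  have he' : e i = -derivative (∑ k ∈ Finset.range i, h k) := by
    rw [he, derivative_sum]
  simp only [he', eval_neg]
  rw [intervalIntegral.integral_neg, intervalIntegral.integral_eq_sub_of_hasDerivAt
    (fun x _ => Polynomial.hasDerivAt _ x) ((Polynomial.continuous _).intervalIntegrable _ _),
    hsum j hjN, hsum (j - 1) (by omega)]
  split_ifs <;> first | omega | norm_num
end

section
/- The edge polynomials e_1, …, e_N are linearly independent over ℝ: if real coefficients c_1, …, c_N satisfy Σ_{i=1}^{N} c_i e_i(ξ) = 0 as a polynomial, then c_1 = … = c_N = 0. -/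
open Polynomial Finset

/-- The value at a node of a combination of partial sums of a cardinal family is a tail sum of the
coefficients. -/
lemma eval_sum_C_mul_partial_sum {R : Type*} [CommRing R] {N : ℕ} {ξ : ℕ → R} {h : ℕ → R[X]}
    (hval : ∀ i, i ≤ N → ∀ j, j ≤ N → (h i).eval (ξ j) = if i = j then 1 else 0)
    (c : ℕ → R) {j : ℕ} (hj : j ≤ N) :
    (∑ i ∈ Icc 1 N, C (c i) * ∑ k ∈ range i, h k).eval (ξ j) = ∑ i ∈ Ioc j N, c i := by
  have hpartial : ∀ i ∈ Icc 1 N,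
      (C (c i) * ∑ k ∈ range i, h k).eval (ξ j) = if j < i then c i else 0 := by
    intro i hi
    have hsum : ∑ k ∈ range i, (h k).eval (ξ j) = ∑ k ∈ range i, if k = j then (1 : R) else 0 :=
      sum_congr rfl fun k hk => hval k (by simp at hk hi; omega) j hj
    rw [eval_mul, eval_C, eval_finsetSum, hsum, sum_ite_eq']
    simp
  rw [eval_finsetSum, sum_congr rfl hpartial, ← sum_filter]
  congr 1
  ext i
  simp
  omega

/-- **Linear independence of the edge polynomials.**
Let `ξ 0 < ξ 1 < … < ξ N` (`N ≥ 1`) be distinct real nodes, `h i` the Lagrange basis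
polynomials (`h i (ξ j) = δᵢⱼ`, degree `≤ N`), and `e j = -∑_{k=0}^{j-1} (h k)'` the
edge polynomials.  If real coefficients `c 1, …, c N` satisfy
`∑_{i=1}^{N} c i · e i = 0` as a polynomial, then `c i = 0` for all `i ∈ {1, …, N}`. -/
theorem edge_polynomials_linearly_independent
    (N : ℕ) (hN : 1 ≤ N)
    (ξ : ℕ → ℝ) (hξ : ∀ i j, i < j → j ≤ N → ξ i < ξ j)
    (h : ℕ → Polynomial ℝ)
    (hdeg : ∀ i, i ≤ N → (h i).degree ≤ (N : ℕ))
    (hval : ∀ i, i ≤ N → ∀ j, j ≤ N → (h i).eval (ξ j) = if i = j then 1 else 0)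
    (e : ℕ → Polynomial ℝ)
    (he : ∀ j, e j = -∑ k ∈ Finset.range j, derivative (h k))
    (c : ℕ → ℝ)
    (hc : (∑ i ∈ Finset.Icc 1 N, C (c i) * e i) = 0) :
    ∀ i, 1 ≤ i → i ≤ N → c i = 0 := by
  intro i hi hiN
  set P : ℝ[X] := ∑ i ∈ Icc 1 N, C (c i) * ∑ k ∈ range i, h k with hP
  have hder : derivative P = 0 := by
    rw [← neg_eq_zero, ← hc, hP]
    simp [he, sum_neg_distrib]
  have htail : ∀ j ≤ N, ∑ i ∈ Ioc j N, c i = 0 := by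
    intro j hj
    rw [← eval_sum_C_mul_partial_sum hval c hj, ← hP, eq_C_of_derivative_eq_zero hder, eval_C,
      ← eval_C (a := P.coeff 0) (x := ξ N), ← eq_C_of_derivative_eq_zero hder, hP,
      eval_sum_C_mul_partial_sum hval c le_rfl, Ioc_self, sum_empty]
  have hsplit := sum_Ioc_consecutive c (Nat.sub_le i 1) hiN
  obtain ⟨m, rfl⟩ := Nat.exists_eq_add_of_le' hi
  rw [htail _ hiN, htail _ (by omega), Nat.add_sub_cancel, Nat.Ioc_succ_singleton,
    sum_singleton, add_zero] at hsplit
  exact hsplit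
end

section
/- The divergence of the tensor-product velocity expansion is given by the metric-free incidence formula: for all (x, y) ∈ ℝ², ∂/∂x [ Σ_{i=0}^{N} Σ_{j=1}^{N} ux_{i,j} h_i(x) e_j(y) ] + ∂/∂y [ Σ_{i=1}^{N} Σ_{j=0}^{N} uy_{i,j} e_i(x) h_j(y) ] = Σ_{i=1}^{N} Σ_{j=1}^{N} ( ux_{i,j} − ux_{i−1,j} + uy_{i,j} − uy_{i,j−1} ) e_i(x) e_j(y). -/
open Polynomial Finset

/-- Summation by parts against a sequence vanishing at both ends. -/
theorem sum_range_mul_sub_succ_eq_sum_Icc {R : Type*} [CommRing R] (N : ℕ) (a E : ℕ → R)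
    (h0 : E 0 = 0) (hN : E (N + 1) = 0) :
    ∑ i ∈ Finset.range (N + 1), a i * (E i - E (i + 1))
      = ∑ i ∈ Finset.Icc 1 N, (a i - a (i - 1)) * E i := by
  have key : ∀ n, ∑ i ∈ Finset.range (n + 1), a i * (E i - E (i + 1))
      = ∑ i ∈ Finset.Icc 1 n, (a i - a (i - 1)) * E i - a n * E (n + 1) := by
    intro n
    induction n with
    | zero => simp [h0]
    | succ n ih =>
      rw [Finset.sum_range_succ, ih, Finset.sum_Icc_succ_top (by omega), Nat.add_sub_cancel]
      ring
  rw [key N, hN, mul_zero, sub_zero]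

/-- Polynomials of degree at most `N` forming a nodal basis at `N + 1` distinct nodes sum to one. -/
theorem sum_nodal_basis_eq_one {K : Type*} [Field K] (N : ℕ) (ξ : ℕ → K)
    (hξ : Set.InjOn ξ (Finset.range (N + 1))) (h : ℕ → Polynomial K)
    (hdeg : ∀ i, i ≤ N → (h i).degree ≤ (N : ℕ))
    (hval : ∀ i, i ≤ N → ∀ j, j ≤ N → (h i).eval (ξ j) = if i = j then 1 else 0) :
    ∑ k ∈ Finset.range (N + 1), h k = 1 := by
  have hlt : (N : WithBot ℕ) < ((Finset.range (N + 1)).card : WithBot ℕ) := by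
    rw [Finset.card_range]
    exact_mod_cast Nat.lt_succ_self N
  refine Polynomial.eq_of_degrees_lt_of_eval_index_eq _ hξ (lt_of_le_of_lt ?_ hlt)
    (lt_of_le_of_lt ?_ hlt) ?_
  · exact (Polynomial.degree_sum_le _ _).trans
      (Finset.sup_le fun i hi => hdeg i (Finset.mem_range_succ_iff.mp hi))
  · exact Polynomial.degree_one_le.trans (by exact_mod_cast Nat.zero_le N)
  · intro j hj
    rw [Polynomial.eval_finsetSum, Polynomial.eval_one, Finset.sum_congr rfl fun i hi =>
      hval i (Finset.mem_range_succ_iff.mp hi) j (Finset.mem_range_succ_iff.mp hj)]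
    rw [Finset.sum_ite_eq' _ j, if_pos hj]

/-- **Metric-free incidence formula for the discrete divergence.**
Let `ξ 0 < ξ 1 < … < ξ N` (`N ≥ 1`) be distinct real nodes, `h i` the Lagrange
basis polynomials (`h i (ξ j) = δᵢⱼ`, degree `≤ N`), and
`e j = -∑_{k=0}^{j-1} (h k)'` the edge polynomials.  Given degrees of freedom
`ux i j` and `uy i j`, the divergence of the tensor-product velocity expansion
satisfies, for all `(x, y) ∈ ℝ²`,
`∂/∂x [∑ᵢ∑ⱼ ux i j · h i (x) · e j (y)] + ∂/∂y [∑ᵢ∑ⱼ uy i j · e i (x) · h j (y)]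
  = ∑ᵢ∑ⱼ (ux i j - ux (i-1) j + uy i j - uy i (j-1)) · e i (x) · e j (y)`. -/
theorem discrete_divergence_incidence_formula
    (N : ℕ) (hN : 1 ≤ N)
    (ξ : ℕ → ℝ) (hξ : ∀ i j, i < j → j ≤ N → ξ i < ξ j)
    (h : ℕ → Polynomial ℝ)
    (hdeg : ∀ i, i ≤ N → (h i).degree ≤ (N : ℕ))
    (hval : ∀ i, i ≤ N → ∀ j, j ≤ N → (h i).eval (ξ j) = if i = j then 1 else 0)
    (e : ℕ → Polynomial ℝ)
    (he : ∀ j, e j = -∑ k ∈ Finset.range j, derivative (h k))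
    (ux uy : ℕ → ℕ → ℝ) :
    ∀ x y : ℝ,
      deriv (fun x' : ℝ => ∑ i ∈ Finset.range (N + 1), ∑ j ∈ Finset.Icc 1 N,
          ux i j * (h i).eval x' * (e j).eval y) x
      + deriv (fun y' : ℝ => ∑ i ∈ Finset.Icc 1 N, ∑ j ∈ Finset.range (N + 1),
          uy i j * (e i).eval x * (h j).eval y') y
      = ∑ i ∈ Finset.Icc 1 N, ∑ j ∈ Finset.Icc 1 N,
          (ux i j - ux (i - 1) j + uy i j - uy i (j - 1))
            * (e i).eval x * (e j).eval y := by
  intro x y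
  have hinj : Set.InjOn ξ (Finset.range (N + 1)) := by
    refine StrictMonoOn.injOn fun i _ j hj hij => hξ i j hij ?_
    exact Finset.mem_range_succ_iff.mp hj
  have he0 : e 0 = 0 := by simp [he]
  have heN : e (N + 1) = 0 := by
    rw [he, ← Polynomial.derivative_sum, sum_nodal_basis_eq_one N ξ hinj h hdeg hval]
    simp
  have hder : ∀ i, derivative (h i) = e i - e (i + 1) := by
    intro i
    rw [he, he, Finset.sum_range_succ]
    ring
  have parts : ∀ (a : ℕ → ℝ) (t : ℝ),
      ∑ i ∈ Finset.range (N + 1), a i * (derivative (h i)).eval t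
        = ∑ i ∈ Finset.Icc 1 N, (a i - a (i - 1)) * (e i).eval t := by
    intro a t
    simp only [hder, Polynomial.eval_sub]
    exact sum_range_mul_sub_succ_eq_sum_Icc N a (fun i => (e i).eval t) (by simp [he0])
      (by simp [heN])
  have hx : HasDerivAt (fun x' : ℝ => ∑ i ∈ Finset.range (N + 1), ∑ j ∈ Finset.Icc 1 N,
      ux i j * (h i).eval x' * (e j).eval y)
      (∑ i ∈ Finset.range (N + 1), ∑ j ∈ Finset.Icc 1 N,
        ux i j * (derivative (h i)).eval x * (e j).eval y) x :=
    HasDerivAt.fun_sum fun i _ => HasDerivAt.fun_sum fun j _ =>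
      (((h i).hasDerivAt x).const_mul (ux i j)).mul_const _
  have hy : HasDerivAt (fun y' : ℝ => ∑ i ∈ Finset.Icc 1 N, ∑ j ∈ Finset.range (N + 1),
      uy i j * (e i).eval x * (h j).eval y')
      (∑ i ∈ Finset.Icc 1 N, ∑ j ∈ Finset.range (N + 1),
        uy i j * (e i).eval x * (derivative (h j)).eval y) y :=
    HasDerivAt.fun_sum fun i _ => HasDerivAt.fun_sum fun j _ =>
      ((h j).hasDerivAt y).const_mul _
  have hsx : ∑ i ∈ Finset.range (N + 1), ∑ j ∈ Finset.Icc 1 N,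
      ux i j * (derivative (h i)).eval x * (e j).eval y
      = ∑ i ∈ Finset.Icc 1 N, ∑ j ∈ Finset.Icc 1 N,
        (ux i j - ux (i - 1) j) * (e i).eval x * (e j).eval y := by
    rw [Finset.sum_comm, Finset.sum_comm (s := Finset.Icc 1 N) (t := Finset.Icc 1 N)]
    refine Finset.sum_congr rfl fun j _ => ?_
    rw [← Finset.sum_mul, ← Finset.sum_mul, parts fun i => ux i j]
  have hsy : ∑ i ∈ Finset.Icc 1 N, ∑ j ∈ Finset.range (N + 1),
      uy i j * (e i).eval x * (derivative (h j)).eval y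
      = ∑ i ∈ Finset.Icc 1 N, ∑ j ∈ Finset.Icc 1 N,
        (uy i j - uy i (j - 1)) * (e i).eval x * (e j).eval y := by
    refine Finset.sum_congr rfl fun i _ => ?_
    rw [parts fun j => uy i j * (e i).eval x]
    exact Finset.sum_congr rfl fun j _ => by ring
  rw [hx.deriv, hy.deriv, hsx, hsy]
  simp only [← Finset.sum_add_distrib]
  exact Finset.sum_congr rfl fun i _ => Finset.sum_congr rfl fun j _ => by ring
end
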